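/- arXiv:1107.5893 — 6 statements merged into one kernel-verified Lean document; each statement's English description precedes it below -/
import Mathlib

section
/- Let r̄ ≥ 0 be a real number and let (w_j)_{j≥0} be a sequence of nonnegative real numbers with w_0 = 1 such that w_j ≤ r̄ · Σ_{s=0}^{j-1} w_{j-1-s} · w_s for all j ≥ 1. Then for every j ≥ 1, w_j ≤ (4r̄)^j · α_j, where α_j = 2 · (2j−1)!! / (2j+2)!!. -/
open Nat Finset

lemma catalan_rec_aux (n : ℕ) :
    (n + 2) * catalan (n + 1) = 2 * (2 * n + 1) * catalan n := by
  have h1 := succ_mul_catalan_eq_centralBinom n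
  have h2 := succ_mul_catalan_eq_centralBinom (n + 1)
  have h3 := Nat.succ_mul_centralBinom_succ n
  rw [← h1, ← h2] at h3
  apply Nat.eq_of_mul_eq_mul_left (Nat.succ_pos n)
  rw [Nat.succ_eq_add_one]
  linarith

lemma catalan_doubleFactorial_aux (n : ℕ) :
    catalan n * (2 * n + 2)‼ = 4 ^ n * (2 * (2 * n - 1)‼) := by
  induction n with
  | zero => simp [Nat.doubleFactorial]
  | succ n ih =>
    have h1 : (2 * (n + 1) + 2)‼ = (2 * n + 4) * (2 * n + 2)‼ := Nat.doubleFactorial_add_two _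
    have h2 : (2 * (n + 1) - 1)‼ = (2 * n + 1) * (2 * n - 1)‼ := by
      cases n with
      | zero => simp
      | succ m => exact Nat.doubleFactorial_add_two (2 * m + 1)
    have h3 := catalan_rec_aux n
    rw [h1, h2]
    calc _ = 2 * ((n + 2) * catalan (n + 1)) * (2 * n + 2)‼ := by ring
      _ = 4 * (2 * n + 1) * (catalan n * (2 * n + 2)‼) := by rw [h3]; ring
      _ = _ := by rw [ih]; ring

theorem statement_3 (r : ℝ) (hr : 0 ≤ r) (w : ℕ → ℝ) (hw_nonneg : ∀ j, 0 ≤ w j)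
    (hw0 : w 0 = 1)
    (hwrec : ∀ j : ℕ, 1 ≤ j → w j ≤ r * ∑ s ∈ Finset.range j, w (j - 1 - s) * w s) :
    ∀ j : ℕ, 1 ≤ j →
      w j ≤ (4 * r) ^ j * (2 * ((2 * j - 1)‼ : ℝ) / ((2 * j + 2)‼ : ℝ)) := by
  have key : ∀ j : ℕ, w j ≤ r ^ j * catalan j := by
    intro j
    induction j using Nat.strong_induction_on with
    | _ j ih =>
      cases j with
      | zero => simp [hw0]
      | succ n =>
        refine (hwrec (n + 1) (by omega)).trans ?_
        rw [catalan_succ, Fin.sum_univ_eq_sum_range (fun i => catalan i * catalan (n - i)),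
          _root_.pow_succ', mul_assoc]
        refine mul_le_mul_of_nonneg_left ?_ hr
        push_cast
        rw [Finset.mul_sum]
        refine Finset.sum_le_sum fun s hs => ?_
        have hs' : s < n + 1 := Finset.mem_range.1 hs
        calc w (n - s) * w s ≤ (r ^ (n - s) * catalan (n - s)) * (r ^ s * catalan s) :=
              mul_le_mul (ih _ (by omega)) (ih _ hs') (hw_nonneg _) (by positivity)
          _ = r ^ ((n - s) + s) * (catalan s * catalan (n - s)) := by rw [pow_add]; ring
          _ = _ := by rw [Nat.sub_add_cancel (by omega)]
  intro j _
  refine (key j).trans (le_of_eq ?_)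
  have h : (catalan j : ℝ) * ((2 * j + 2)‼ : ℝ) = 4 ^ j * (2 * ((2 * j - 1)‼ : ℝ)) := by
    exact_mod_cast catalan_doubleFactorial_aux j
  have hp : ((2 * j + 2)‼ : ℝ) ≠ 0 := by
    exact_mod_cast (Nat.doubleFactorial_pos _).ne'
  rw [mul_pow, ← mul_div_assoc, eq_div_iff hp, mul_assoc, h]
  ring
end

section
/- For every natural number m ≥ 1, 2 · (2m−1)!! / (2m+2)!! ≤ 1 / ((m+1) · √(π m)). -/
open Nat Real

theorem wallis_aux (k : ℕ) :
    Real.Wallis.W (k + 1) * (2 * k + 3) * ((2 * k + 1)‼ : ℝ) ^ 2 = ((2 * k + 2)‼ : ℝ) ^ 2 := by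
  induction k with
  | zero => norm_num [Real.Wallis.W, Nat.doubleFactorial]
  | succ k ih =>
    rw [Real.Wallis.W_succ, show 2 * (k + 1) + 1 = (2 * k + 1) + 2 by ring,
      show 2 * (k + 1) + 2 = (2 * k + 2) + 2 by ring,
      Nat.doubleFactorial_add_two (2 * k + 1), Nat.doubleFactorial_add_two (2 * k + 2)]
    push_cast
    rw [mul_pow, mul_pow, ← ih]
    have h1 : (2 * (k : ℝ) + 3) ≠ 0 := by positivity
    have h2 : (2 * (k : ℝ) + 5) ≠ 0 := by positivity
    have e1 : (2 * ((k : ℝ) + 1) + 1) = 2 * k + 3 := by ring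
    have e2 : (2 * ((k : ℝ) + 1) + 3) = 2 * k + 5 := by ring
    rw [e1, e2]
    field_simp
    ring

theorem statement_4 (m : ℕ) (hm : 1 ≤ m) :
    2 * ((2 * m - 1)‼ : ℝ) / ((2 * m + 2)‼ : ℝ) ≤
      1 / ((m + 1) * Real.sqrt (Real.pi * m)) := by
  obtain ⟨k, rfl⟩ : ∃ k, m = k + 1 := ⟨m - 1, by omega⟩
  have h := wallis_aux k
  have hW := Real.Wallis.le_W (k + 1)
  rw [show 2 * (k + 1) - 1 = 2 * k + 1 by omega,
    show 2 * (k + 1) + 2 = (2 * k + 2) + 2 by ring, Nat.doubleFactorial_add_two (2 * k + 2)]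
  have ha : (0 : ℝ) < ((2 * k + 1)‼ : ℝ) := by exact_mod_cast Nat.doubleFactorial_pos _
  have hb : (0 : ℝ) < ((2 * k + 2)‼ : ℝ) := by exact_mod_cast Nat.doubleFactorial_pos _
  push_cast at hW ⊢
  generalize ((2 * k + 1)‼ : ℝ) = a at *
  generalize ((2 * k + 2)‼ : ℝ) = b at *
  have hpi := Real.pi_pos
  have key : Real.pi * (k + 1) * a ^ 2 ≤ b ^ 2 := by
    rw [← h]
    refine mul_le_mul_of_nonneg_right ?_ (sq_nonneg a)
    refine le_trans ?_ (mul_le_mul_of_nonneg_right hW (by positivity))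
    rw [_root_.div_mul_div_comm, _root_.div_mul_eq_mul_div, le_div_iff₀ (by positivity)]
    nlinarith
  have hs : a * Real.sqrt (Real.pi * (k + 1)) ≤ b := by
    refine le_of_sq_le_sq ?_ hb.le
    rw [mul_pow, Real.sq_sqrt (by positivity)]
    linarith
  rw [div_le_div_iff₀ (by positivity) (by positivity)]
  nlinarith [mul_le_mul_of_nonneg_left hs (show (0 : ℝ) ≤ 2 * (k + 2) by positivity)]
end

section
/- The series Σ_{j=0}^∞ C_j / 4^j, where C_j is the j-th Catalan number, converges and its sum equals 2. -/
theorem aux_step (n : ℕ) : ((n + 1).centralBinom : ℝ) / 4 ^ (n + 1)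
    = (n.centralBinom : ℝ) / 4 ^ n * ((2 * n + 1) / (2 * n + 2)) := by
  have h : ((n : ℝ) + 1) * ((n + 1).centralBinom : ℝ) = 2 * (2 * n + 1) * n.centralBinom := by
    exact_mod_cast Nat.succ_mul_centralBinom_succ n
  have h0 : (n : ℝ) + 1 ≠ 0 := by positivity
  have h1 : ((n + 1).centralBinom : ℝ) = 2 * (2 * n + 1) * n.centralBinom / (n + 1) := by
    rw [eq_div_iff h0, ← h]; ring
  have h2 : (2 * (n : ℝ) + 2) = 2 * (n + 1) := by ring
  rw [h1, h2, pow_succ]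
  field_simp
  ring

theorem aux_bound (n : ℕ) : ((n.centralBinom : ℝ) / 4 ^ n) ^ 2 * (2 * n + 1) ≤ 1 := by
  induction n with
  | zero => simp
  | succ k ih =>
    rw [aux_step]
    refine le_trans ?_ ih
    push_cast
    rw [mul_pow, mul_assoc]
    apply mul_le_mul_of_nonneg_left _ (sq_nonneg _)
    rw [div_pow, div_mul_eq_mul_div, div_le_iff₀ (by positivity)]
    have : (0 : ℝ) ≤ k := Nat.cast_nonneg k
    nlinarith

theorem aux_tendsto : Filter.Tendsto (fun n : ℕ => (n.centralBinom : ℝ) / 4 ^ n)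
    Filter.atTop (nhds 0) := by
  have h := (tendsto_one_div_add_atTop_nhds_zero_nat (𝕜 := ℝ)).sqrt
  rw [Real.sqrt_zero] at h
  refine squeeze_zero (fun n => by positivity) (fun n => ?_) h
  apply Real.le_sqrt_of_sq_le
  rw [le_div_iff₀ (by positivity)]
  refine le_trans ?_ (aux_bound n)
  apply mul_le_mul_of_nonneg_left _ (sq_nonneg _)
  have : (0 : ℝ) ≤ n := Nat.cast_nonneg n
  linarith

theorem aux_sum (n : ℕ) : ∑ j ∈ Finset.range n, (catalan j : ℝ) / 4 ^ j
    = 2 - 2 * ((n.centralBinom : ℝ) / 4 ^ n) := by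
  induction n with
  | zero => simp
  | succ k ih =>
    rw [Finset.sum_range_succ, ih, aux_step]
    have h : ((k : ℝ) + 1) * catalan k = k.centralBinom := by
      exact_mod_cast succ_mul_catalan_eq_centralBinom k
    rw [← h]
    have h2 : (2 * (k : ℝ) + 2) = 2 * (k + 1) := by ring
    rw [h2]
    field_simp
    ring

theorem statement_8 :
    HasSum (fun j : ℕ => (catalan j : ℝ) / 4 ^ j) 2 := by
  rw [hasSum_iff_tendsto_nat_of_nonneg (fun j => by positivity)]
  simp_rw [aux_sum]
  simpa using (aux_tendsto.const_mul 2).const_sub 2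
end

section
/- For every natural number m ≥ 2, the series Σ_{j=m}^∞ 1 / ((j+1)·√(π j)) converges and Σ_{j=m}^∞ 1 / ((j+1)·√(π j)) ≤ (2/√π) · arctan(1/√(m−1)). -/
lemma step_bound (x : ℝ) (hx : 2 ≤ x) :
    1 / ((x + 1) * Real.sqrt x) ≤
      2 * Real.arctan (Real.sqrt x) - 2 * Real.arctan (Real.sqrt (x - 1)) := by
  have hd : ∀ t : ℝ, 0 < t →
      HasDerivAt (fun t => 2 * Real.arctan (Real.sqrt t)) (1 / ((t + 1) * Real.sqrt t)) t := by
    intro t ht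
    have h := ((Real.hasDerivAt_sqrt ht.ne').arctan).const_mul 2
    have hs : 0 < Real.sqrt t := Real.sqrt_pos.mpr ht
    have e : 2 * (1 / (1 + Real.sqrt t ^ 2) * (1 / (2 * Real.sqrt t))) =
        1 / ((t + 1) * Real.sqrt t) := by
      rw [Real.sq_sqrt ht.le]
      field_simp
      ring
    rw [← e]
    exact h
  obtain ⟨c, hc, he⟩ := exists_hasDerivAt_eq_slope
    (fun t => 2 * Real.arctan (Real.sqrt t)) (fun t => 1 / ((t + 1) * Real.sqrt t))
    (show x - 1 < x by linarith)
    (fun t ht => (hd t (by linarith [ht.1])).continuousAt.continuousWithinAt)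
    (fun t ht => hd t (by linarith [ht.1]))
  have hc0 : 0 < c := by linarith [hc.1]
  have hs : 0 < Real.sqrt c := Real.sqrt_pos.mpr hc0
  have h1 : x - (x - 1) = 1 := by ring
  rw [h1, div_one] at he
  rw [← he]
  have h2 : Real.sqrt c ≤ Real.sqrt x := Real.sqrt_le_sqrt hc.2.le
  have h3 := hc.2.le
  gcongr

theorem statement_11 (m : ℕ) (hm : 2 ≤ m) :
    Summable (fun j : ℕ =>
      1 / (((m + j : ℕ) + 1 : ℝ) * Real.sqrt (Real.pi * (m + j : ℕ)))) ∧
    ∑' j : ℕ, 1 / (((m + j : ℕ) + 1 : ℝ) * Real.sqrt (Real.pi * (m + j : ℕ))) ≤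
      (2 / Real.sqrt Real.pi) * Real.arctan (1 / Real.sqrt ((m : ℝ) - 1)) := by
  have hm' : (2 : ℝ) ≤ m := by exact_mod_cast hm
  have hp : 0 < Real.sqrt Real.pi := Real.sqrt_pos.mpr Real.pi_pos
  have hnn : ∀ j : ℕ,
      0 ≤ 1 / (((m + j : ℕ) + 1 : ℝ) * Real.sqrt (Real.pi * (m + j : ℕ))) := by
    intro j; positivity
  have hpart : ∀ n : ℕ, ∑ j ∈ Finset.range n,
      1 / (((m + j : ℕ) + 1 : ℝ) * Real.sqrt (Real.pi * (m + j : ℕ))) ≤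
      (1 / Real.sqrt Real.pi) * (2 * Real.arctan (Real.sqrt ((m : ℝ) + n - 1))
        - 2 * Real.arctan (Real.sqrt ((m : ℝ) - 1))) := by
    intro n
    induction n with
    | zero => simp
    | succ n ih =>
      rw [Finset.sum_range_succ]
      have h := step_bound ((m + n : ℕ) : ℝ) (by push_cast; linarith [Nat.cast_nonneg (α := ℝ) n])
      have h' := mul_le_mul_of_nonneg_left h (one_div_pos.mpr hp).le
      have e : 1 / (((m + n : ℕ) + 1 : ℝ) * Real.sqrt (Real.pi * (m + n : ℕ))) =
          1 / Real.sqrt Real.pi * (1 / (((m + n : ℕ) + 1 : ℝ) * Real.sqrt (m + n : ℕ))) := by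
        rw [Real.sqrt_mul Real.pi_pos.le, one_div_mul_one_div]
        congr 1
        ring
      rw [e]
      have e2 : (m : ℝ) + (n + 1 : ℕ) - 1 = (m + n : ℕ) := by push_cast; ring
      rw [e2]
      have e3 : ((m + n : ℕ) : ℝ) - 1 = m + n - 1 := by push_cast; ring
      rw [e3] at h'
      linarith
  have hbd : ∀ n : ℕ, ∑ j ∈ Finset.range n,
      1 / (((m + j : ℕ) + 1 : ℝ) * Real.sqrt (Real.pi * (m + j : ℕ))) ≤
      (2 / Real.sqrt Real.pi) * Real.arctan (1 / Real.sqrt ((m : ℝ) - 1)) := by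
    intro n
    refine (hpart n).trans ?_
    rw [one_div (Real.sqrt ((m : ℝ) - 1)),
      Real.arctan_inv_of_pos (Real.sqrt_pos.mpr (by linarith))]
    have h := Real.arctan_lt_pi_div_two (Real.sqrt ((m : ℝ) + n - 1))
    have e : ∀ y : ℝ, 2 / Real.sqrt Real.pi * y = 1 / Real.sqrt Real.pi * (2 * y) := by
      intro y; ring
    rw [e]
    apply mul_le_mul_of_nonneg_left _ (one_div_pos.mpr hp).le
    linarith
  exact ⟨summable_of_sum_range_le hnn hbd, Real.tsum_le_of_sum_range_le hnn hbd⟩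
end

section
/- For every natural number m ≥ 2, Σ_{j=m}^∞ 2·(2j−1)!!/(2j+2)!! converges and Σ_{j=m}^∞ 2·(2j−1)!!/(2j+2)!! ≤ (2/√π) · arctan(1/√(m−1)). -/
open Nat

/-- The ratio (2k-1)!!/(2k)!!. -/
noncomputable def ratioA (k : ℕ) : ℝ := ((2 * k - 1)‼ : ℝ) / ((2 * k)‼ : ℝ)

lemma ratioA_nonneg (k : ℕ) : 0 ≤ ratioA k := by unfold ratioA; positivity

lemma ratioA_succ (k : ℕ) : ratioA (k + 1) = ratioA k * ((2 * k + 1) / (2 * k + 2)) := by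
  unfold ratioA
  have h1 : (2 * (k + 1) - 1)‼ = (2 * k + 1) * (2 * k - 1)‼ := by
    have : 2 * (k + 1) - 1 = 2 * k + 1 := by omega
    rw [this, Nat.doubleFactorial_add_one]
  have h2 : (2 * (k + 1))‼ = (2 * k + 2) * (2 * k)‼ := Nat.doubleFactorial_add_two (2 * k)
  rw [h1, h2]
  push_cast
  have : ((2 * k)‼ : ℝ) ≠ 0 := by positivity
  field_simp

lemma term_eq (k : ℕ) :
    2 * ((2 * k - 1)‼ : ℝ) / ((2 * k + 2)‼ : ℝ) = 2 * ratioA k - 2 * ratioA (k + 1) := by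
  rw [ratioA_succ, Nat.doubleFactorial_add_two]
  unfold ratioA
  push_cast
  have : ((2 * k)‼ : ℝ) ≠ 0 := by positivity
  field_simp
  ring

lemma W_ratioA (k : ℕ) : Real.Wallis.W k * (ratioA k ^ 2 * (2 * k + 1)) = 1 := by
  induction k with
  | zero => simp [Real.Wallis.W, ratioA]
  | succ k ih =>
    rw [Real.Wallis.W_succ, ratioA_succ]
    refine Eq.trans ?_ ih
    push_cast
    field_simp
    ring

lemma ratioA_sq_le (k : ℕ) : ratioA k ^ 2 * (Real.pi * k) ≤ 1 := by
  have h1 := Real.Wallis.le_W k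
  have h2 := W_ratioA k
  rw [← h2]
  have h3 : Real.pi * k ≤ Real.Wallis.W k * (2 * k + 1) := by
    refine le_trans ?_ (mul_le_mul_of_nonneg_right h1 (by positivity))
    rw [div_mul_eq_mul_div, div_mul_eq_mul_div, le_div_iff₀ (by positivity)]
    nlinarith [Real.pi_pos]
  nlinarith [mul_le_mul_of_nonneg_left h3 (sq_nonneg (ratioA k))]

lemma ratioA_le (m : ℕ) (hm : 2 ≤ m) :
    ratioA m ≤ 1 / Real.sqrt Real.pi * Real.arctan (1 / Real.sqrt ((m : ℝ) - 1)) := by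
  have hm' : (2 : ℝ) ≤ m := by exact_mod_cast hm
  have hp := Real.pi_pos
  have h1 : ratioA m ≤ 1 / Real.sqrt Real.pi * (1 / Real.sqrt m) := by
    refine (abs_le_of_sq_le_sq' ?_ (by positivity)).2
    rw [mul_pow, div_pow, div_pow, Real.sq_sqrt hp.le, Real.sq_sqrt (by positivity), one_pow,
      one_div_mul_one_div_rev, le_div_iff₀ (by positivity)]
    linarith [ratioA_sq_le m]
  refine h1.trans (mul_le_mul_of_nonneg_left ?_ (by positivity))
  set x := 1 / Real.sqrt ((m : ℝ) - 1) with hx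
  have hxp : 0 < x := by
    have : 0 < (m : ℝ) - 1 := by linarith
    positivity
  have h2 := Real.sin_le (Real.arctan_nonneg.2 hxp.le)
  rw [Real.sin_arctan] at h2
  refine le_trans (le_of_eq ?_) h2
  have hs : 0 < Real.sqrt ((m : ℝ) - 1) := Real.sqrt_pos.2 (by linarith)
  have hq : 1 + x ^ 2 = m / (m - 1) := by
    rw [hx, div_pow, Real.sq_sqrt (by linarith)]
    have : (m : ℝ) - 1 ≠ 0 := by linarith
    field_simp
    ring
  rw [hq, Real.sqrt_div (by positivity), hx]
  have : 0 < Real.sqrt (m : ℝ) := Real.sqrt_pos.2 (by linarith)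
  field_simp

theorem statement_13 (m : ℕ) (hm : 2 ≤ m) :
    Summable (fun j : ℕ =>
      2 * ((2 * (m + j) - 1)‼ : ℝ) / ((2 * (m + j) + 2)‼ : ℝ)) ∧
    ∑' j : ℕ, 2 * ((2 * (m + j) - 1)‼ : ℝ) / ((2 * (m + j) + 2)‼ : ℝ) ≤
      (2 / Real.sqrt Real.pi) * Real.arctan (1 / Real.sqrt ((m : ℝ) - 1)) := by
  have hs : ∀ n, ∑ j ∈ Finset.range n,
      2 * ((2 * (m + j) - 1)‼ : ℝ) / ((2 * (m + j) + 2)‼ : ℝ) ≤ 2 * ratioA m := by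
    intro n
    simp_rw [term_eq]
    have := Finset.sum_range_sub' (fun j => 2 * ratioA (m + j)) n
    simp only [← add_assoc] at this
    rw [this]
    have := ratioA_nonneg (m + n)
    simp only [add_zero]
    linarith
  have h0 : ∀ j : ℕ, 0 ≤ 2 * ((2 * (m + j) - 1)‼ : ℝ) / ((2 * (m + j) + 2)‼ : ℝ) :=
    fun j => by positivity
  refine ⟨summable_of_sum_range_le h0 hs, (Real.tsum_le_of_sum_range_le h0 hs).trans ?_⟩
  have := ratioA_le m hm
  calc 2 * ratioA m ≤ 2 * (1 / Real.sqrt Real.pi * Real.arctan (1 / Real.sqrt ((m : ℝ) - 1))) := by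
        linarith
    _ = _ := by ring
end

section
/- For every natural number j ≥ 1, 2·(2j−1)!!/(2j+2)!! = (1/(j+1)) · ((2j−1)!!/(2j)!!), and (2j−1)!!/(2j)!! = C(2j, j)/4^j, where C(2j, j) is the central binomial coefficient; consequently C(2j, j) ≤ 4^j/√(π j). -/
open Nat

theorem statement_19 (j : ℕ) (hj : 1 ≤ j) :
    2 * ((2 * j - 1)‼ : ℝ) / ((2 * j + 2)‼ : ℝ) =
      (1 / ((j : ℝ) + 1)) * (((2 * j - 1)‼ : ℝ) / ((2 * j)‼ : ℝ)) ∧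
    ((2 * j - 1)‼ : ℝ) / ((2 * j)‼ : ℝ) = ((2 * j).choose j : ℝ) / 4 ^ j ∧
    ((2 * j).choose j : ℝ) ≤ 4 ^ j / Real.sqrt (Real.pi * j) := by
  have hpos : (0 : ℝ) < ((2 * j)‼ : ℕ) := by exact_mod_cast Nat.doubleFactorial_pos _
  have hj0 : (0 : ℝ) < j := by exact_mod_cast hj
  have hfp : (0 : ℝ) < (j ! : ℕ) := by exact_mod_cast Nat.factorial_pos _
  have hC : (((2 * j).choose j : ℕ) : ℝ) * (j ! : ℕ) * (j ! : ℕ) = ((2 * j)! : ℕ) := by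
    have := Nat.choose_mul_factorial_mul_factorial (show j ≤ 2 * j by omega)
    rw [show 2 * j - j = j by omega] at this
    exact_mod_cast this
  have hCp : (0 : ℝ) < ((2 * j).choose j : ℕ) := by
    exact_mod_cast Nat.choose_pos (by omega)
  refine ⟨?_, ?_, ?_⟩
  · rw [Nat.doubleFactorial_add_two]
    push_cast
    field_simp
  · have h1 : (((2 * j)! : ℕ) : ℝ) = ((2 * j)‼ : ℕ) * ((2 * j - 1)‼ : ℕ) := by
      have := Nat.factorial_eq_mul_doubleFactorial (2 * j - 1)
      rw [show 2 * j - 1 + 1 = 2 * j by omega] at this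
      exact_mod_cast this
    have h2 : (((2 * j)‼ : ℕ) : ℝ) = 2 ^ j * (j ! : ℕ) := by
      exact_mod_cast Nat.doubleFactorial_two_mul j
    rw [div_eq_div_iff hpos.ne' (by positivity)]
    rw [← hC, h2] at h1
    rw [h2, show (4 : ℝ) ^ j = 2 ^ j * 2 ^ j by rw [← mul_pow]; norm_num]
    have h3 : (2 : ℝ) ^ j * ((2 * j - 1)‼ : ℕ) = ((2 * j).choose j : ℕ) * (j ! : ℕ) := by
      apply mul_right_cancel₀ hfp.ne'
      linarith
    linear_combination (2 : ℝ) ^ j * h3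
  · have hW := Real.Wallis.le_W j
    rw [Real.Wallis.W_eq_factorial_ratio, ← hC] at hW
    set C : ℝ := (((2 * j).choose j : ℕ) : ℝ) with hCdef
    have e : (2 : ℝ) ^ (4 * j) * (j ! : ℕ) ^ 4 / ((C * (j ! : ℕ) * (j ! : ℕ)) ^ 2 * (2 * j + 1))
        = (4 ^ j) ^ 2 / (C ^ 2 * (2 * j + 1)) := by
      rw [show (2 : ℝ) ^ (4 * j) = (4 ^ j) ^ 2 by
        rw [← pow_mul, mul_comm j 2, pow_mul, pow_mul]; norm_num]
      field_simp
    rw [e, le_div_iff₀ (by positivity)] at hW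
    have key : (C ^ 2) * (Real.pi * j) ≤ (4 ^ j) ^ 2 := by
      refine le_trans ?_ hW
      have : ((2 : ℝ) * j + 1) / (2 * j + 2) * (Real.pi / 2) * (C ^ 2 * (2 * j + 1))
          = C ^ 2 * (Real.pi * ((2 * j + 1) ^ 2 / (4 * (j + 1)))) := by
        field_simp
        ring
      rw [this]
      have : (j : ℝ) ≤ (2 * j + 1) ^ 2 / (4 * (j + 1)) := by
        rw [le_div_iff₀ (by positivity)]
        nlinarith
      have := Real.pi_pos
      gcongr
    have hpi := Real.pi_pos
    rw [le_div_iff₀ (by positivity)]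
    refine le_of_abs_le (abs_le_of_sq_le_sq ?_ (by positivity))
    rw [mul_pow, Real.sq_sqrt (by positivity)]
    exact key
end
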